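/- Assume there exist τ* ≥ 2 with C_t = μ² for every t ≥ τ* (finite full mixing time) and B with Var(S_τ) ≤ B for every τ ≥ 0. Define g(t) := t·(τ* + 1/2)·μ² − E[(S_t)²]/2 for every t ≥ 0. Then the 2-point time correlator is the discrete time-Laplacian of g: C_0 = 2·g(1) − g(2); C_t = 2·g(t+1) − g(t+2) − g(t) for every 1 ≤ t ≤ τ*−2; and C_{τ*−1} = g(τ*) − g(τ*−1). (The solution formula of the paper's Lemma 5.4, expressing the time transport correlations ⟨u W^t u⟩ through the second moment of the integrated transport over time; applicable, e.g., to the avalanche size in the 1D Directed Stochastic Sandpile and Oslo models and to the dissipated particle number in the Activated Random Walk with reflecting/absorbing boundaries.) -/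

import Mathlib

open Finset

/-- Expectation with respect to the stationary path measure of length `τ`
(paths have `τ + 1` states). -/
noncomputable def pathE {S : Type*} [Fintype S] (P : S → S → ℝ) (pi : S → ℝ) (τ : ℕ)
    (f : (Fin (τ + 1) → S) → ℝ) : ℝ :=
  ∑ x : Fin (τ + 1) → S,
    (pi (x 0) * ∏ t : Fin τ, P (x t.castSucc) (x t.succ)) * f x

/-- Integrated transport `S_τ = ∑_{t=1}^{τ} u (x_{t-1}, x_t)` along a path. -/
noncomputable def intTrans {S : Type*} (u : S → S → ℝ) (τ : ℕ) (x : Fin (τ + 1) → S) : ℝ :=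
  ∑ t : Fin τ, u (x t.castSucc) (x t.succ)

/-- Stationary mean `μ = E[u (x₀, x₁)]`. -/
noncomputable def mu {S : Type*} [Fintype S] (P : S → S → ℝ) (pi : S → ℝ)
    (u : S → S → ℝ) : ℝ :=
  pathE P pi 1 fun x => u (x 0) (x 1)

/-- Time correlator `C_k = E[u (x₀, x₁) · u (x_{k+1}, x_{k+2})]`. -/
noncomputable def corr {S : Type*} [Fintype S] (P : S → S → ℝ) (pi : S → ℝ)
    (u : S → S → ℝ) (k : ℕ) : ℝ :=
  pathE P pi (k + 2) fun x =>
    u (x 0) (x 1) * u (x ⟨k + 1, by omega⟩) (x ⟨k + 2, by omega⟩)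

/-- Variance of the integrated transport `Var(S_τ)`. -/
noncomputable def varS {S : Type*} [Fintype S] (P : S → S → ℝ) (pi : S → ℝ)
    (u : S → S → ℝ) (τ : ℕ) : ℝ :=
  pathE P pi τ (fun x => (intTrans u τ x) ^ 2)
    - (pathE P pi τ (fun x => intTrans u τ x)) ^ 2

theorem intTrans_succ_init {S : Type*} {u : S → S → ℝ} (τ : ℕ) (x : Fin (τ + 2) → S) :
    intTrans u (τ + 1) x =
      intTrans u τ (Fin.init x) + u (x (Fin.last τ).castSucc) (x (Fin.last (τ + 1))) := by
  simp only [intTrans, Fin.sum_univ_castSucc, Fin.init, Fin.succ_castSucc, Fin.succ_last]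

theorem intTrans_succ_tail {S : Type*} {u : S → S → ℝ} (τ : ℕ) (x : Fin (τ + 2) → S) :
    intTrans u (τ + 1) x = u (x 0) (x 1) + intTrans u τ (Fin.tail x) := by
  simp only [intTrans, Fin.sum_univ_succ, Fin.tail, ← Fin.succ_castSucc, Fin.castSucc_zero,
    Fin.succ_zero_eq_one]

section PathExpectation

variable {S : Type*} [Fintype S] {P : S → S → ℝ} {pi : S → ℝ} {u : S → S → ℝ}

/-- Row-stochasticity: forgetting the last state of a path does not change expectations. -/
theorem pathE_init (hProw : ∀ r, ∑ r', P r r' = 1) (τ : ℕ) (f : (Fin (τ + 1) → S) → ℝ) :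
    pathE P pi (τ + 1) (fun x => f (Fin.init x)) = pathE P pi τ f := by
  unfold pathE
  rw [← (Fin.snocEquiv fun _ : Fin (τ + 2) => S).sum_comp, Fintype.sum_prod_type, Finset.sum_comm]
  refine Finset.sum_congr rfl fun y _ => ?_
  have key : ∀ r : S, (pi ((Fin.snoc y r : Fin (τ + 2) → S) 0) *
      ∏ t : Fin (τ + 1), P ((Fin.snoc y r : Fin (τ + 2) → S) t.castSucc)
        ((Fin.snoc y r : Fin (τ + 2) → S) t.succ)) *
        f (Fin.init (Fin.snoc y r : Fin (τ + 2) → S)) =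
      (pi (y 0) * ∏ t : Fin τ, P (y t.castSucc) (y t.succ)) * f y * P (y (Fin.last τ)) r := by
    intro r
    have h0 : (Fin.snoc y r : Fin (τ + 2) → S) 0 = y 0 := by
      rw [← Fin.castSucc_zero, Fin.snoc_castSucc (α := fun _ => S)]
    rw [Fin.prod_univ_castSucc, h0, Fin.init_snoc (α := fun _ => S)]
    simp only [Fin.succ_castSucc, Fin.succ_last, Fin.snoc_castSucc (α := fun _ => S),
      Fin.snoc_last (α := fun _ => S)]
    ring
  calc _ = ∑ r, (pi (y 0) * ∏ t : Fin τ, P (y t.castSucc) (y t.succ)) * f y *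
        P (y (Fin.last τ)) r := Finset.sum_congr rfl fun r _ => key r
    _ = _ := by rw [← Finset.mul_sum, hProw, mul_one]

/-- Stationarity: forgetting the first state of a path does not change expectations. -/
theorem pathE_tail (hstat : ∀ r', ∑ r, pi r * P r r' = pi r') (τ : ℕ)
    (f : (Fin (τ + 1) → S) → ℝ) :
    pathE P pi (τ + 1) (fun x => f (Fin.tail x)) = pathE P pi τ f := by
  unfold pathE
  rw [← (Fin.consEquiv fun _ : Fin (τ + 2) => S).sum_comp, Fintype.sum_prod_type, Finset.sum_comm]
  refine Finset.sum_congr rfl fun y _ => ?_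
  have key : ∀ r : S, (pi ((Fin.cons r y : Fin (τ + 2) → S) 0) *
      ∏ t : Fin (τ + 1), P ((Fin.cons r y : Fin (τ + 2) → S) t.castSucc)
        ((Fin.cons r y : Fin (τ + 2) → S) t.succ)) *
        f (Fin.tail (Fin.cons r y : Fin (τ + 2) → S)) =
      (pi r * P r (y 0)) * ((∏ t : Fin τ, P (y t.castSucc) (y t.succ)) * f y) := by
    intro r
    rw [Fin.prod_univ_succ, Fin.tail_cons (α := fun _ => S)]
    simp only [← Fin.succ_castSucc, Fin.castSucc_zero, Fin.cons_zero, Fin.cons_succ]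
    ring
  calc _ = ∑ r, (pi r * P r (y 0)) * ((∏ t : Fin τ, P (y t.castSucc) (y t.succ)) * f y) :=
        Finset.sum_congr rfl fun r _ => key r
    _ = _ := by rw [← Finset.sum_mul, hstat, mul_assoc]

theorem pathE_add (τ : ℕ) (f h : (Fin (τ + 1) → S) → ℝ) :
    pathE P pi τ (fun x => f x + h x) = pathE P pi τ f + pathE P pi τ h := by
  simp only [pathE, mul_add, Finset.sum_add_distrib]

theorem pathE_const_mul (τ : ℕ) (c : ℝ) (f : (Fin (τ + 1) → S) → ℝ) :
    pathE P pi τ (fun x => c * f x) = c * pathE P pi τ f := by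
  simp only [pathE, Finset.mul_sum]
  exact Finset.sum_congr rfl fun x _ => by ring

theorem pathE_one (hProw : ∀ r, ∑ r', P r r' = 1) (hpisum : ∑ r, pi r = 1) (τ : ℕ) :
    pathE P pi τ (fun _ => 1) = 1 := by
  induction τ with
  | zero =>
    refine Eq.trans ?_ (((Equiv.funUnique (Fin 1) S).sum_comp pi).trans hpisum)
    simp [pathE]
  | succ τ ih => exact (pathE_init hProw τ fun _ => 1).trans ih

theorem pathE_nonneg (hP : ∀ r r', 0 ≤ P r r') (hpi : ∀ r, 0 ≤ pi r) (τ : ℕ)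
    {f : (Fin (τ + 1) → S) → ℝ} (hf : ∀ x, 0 ≤ f x) : 0 ≤ pathE P pi τ f :=
  Finset.sum_nonneg fun x _ =>
    mul_nonneg (mul_nonneg (hpi _) (Finset.prod_nonneg fun _ _ => hP _ _)) (hf x)

theorem varS_nonneg (hP : ∀ r r', 0 ≤ P r r') (hProw : ∀ r, ∑ r', P r r' = 1)
    (hpi : ∀ r, 0 ≤ pi r) (hpisum : ∑ r, pi r = 1) (τ : ℕ) : 0 ≤ varS P pi u τ := by
  set e := pathE P pi τ (fun x => intTrans u τ x) with he
  have h : pathE P pi τ (fun x => (intTrans u τ x - e) ^ 2) = varS P pi u τ := by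
    have hexp : (fun x : Fin (τ + 1) → S => (intTrans u τ x - e) ^ 2) =
        fun x => intTrans u τ x ^ 2 + ((-2 * e) * intTrans u τ x + e ^ 2 * 1) := by
      funext x
      ring
    rw [hexp, pathE_add, pathE_add, pathE_const_mul, pathE_const_mul, pathE_one hProw hpisum,
      ← he, varS, ← he]
    ring
  exact h ▸ pathE_nonneg hP hpi τ fun x => sq_nonneg _

/-- The second difference of the second moment of the integrated transport is `2 C_t`. -/
theorem secondMoment_second_difference (hProw : ∀ r, ∑ r', P r r' = 1)
    (hstat : ∀ r', ∑ r, pi r * P r r' = pi r') (t : ℕ) :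
    pathE P pi (t + 2) (fun x => intTrans u (t + 2) x ^ 2) +
        pathE P pi t (fun x => intTrans u t x ^ 2) =
      2 * pathE P pi (t + 1) (fun x => intTrans u (t + 1) x ^ 2) + 2 * corr P pi u t := by
  have h₁ := pathE_init (pi := pi) hProw (t + 1) fun x => intTrans u (t + 1) x ^ 2
  have h₂ := pathE_tail hstat (t + 1) fun x => intTrans u (t + 1) x ^ 2
  have h₃ := (pathE_tail hstat (t + 1) fun x => intTrans u t (Fin.init x) ^ 2).trans
    (pathE_init (pi := pi) hProw t fun x => intTrans u t x ^ 2)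
  rw [two_mul (pathE P pi (t + 1) _)]
  nth_rewrite 1 [← h₁]
  rw [← h₂, ← h₃, corr, ← pathE_const_mul, ← pathE_add, ← pathE_add, ← pathE_add]
  congr 1
  funext x
  have e₁ := intTrans_succ_init (u := u) (t + 1) x
  have e₂ := intTrans_succ_tail (u := u) t (Fin.init x)
  have e₃ := intTrans_succ_init (u := u) t (Fin.tail x)
  have e₄ : Fin.tail (Fin.init x) = Fin.init (Fin.tail x) := rfl
  have e₅ : u (Fin.init x 0) (Fin.init x 1) = u (x 0) (x 1) := rfl
  have e₆ : u (Fin.tail x (Fin.last t).castSucc) (Fin.tail x (Fin.last (t + 1))) =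
      u (x ⟨t + 1, by omega⟩) (x ⟨t + 2, by omega⟩) := rfl
  have e₇ : u (x (Fin.last (t + 1)).castSucc) (x (Fin.last (t + 1 + 1))) =
      u (x ⟨t + 1, by omega⟩) (x ⟨t + 2, by omega⟩) := rfl
  rw [e₇] at e₁
  rw [e₅, e₄] at e₂
  rw [e₆] at e₃
  rw [e₁, e₂, e₃]
  ring

theorem pathE_intTrans (hProw : ∀ r, ∑ r', P r r' = 1)
    (hstat : ∀ r', ∑ r, pi r * P r r' = pi r') (τ : ℕ) :
    pathE P pi τ (fun x => intTrans u τ x) = τ * mu P pi u := by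
  induction τ with
  | zero => simp [pathE, intTrans]
  | succ τ ih =>
    have hfirst : ∀ n : ℕ, pathE P pi (n + 1) (fun x => u (x 0) (x 1)) = mu P pi u := by
      intro n
      induction n with
      | zero => rfl
      | succ n ihn => exact (pathE_init hProw (n + 1) fun x => u (x 0) (x 1)).trans ihn
    simp only [intTrans_succ_tail]
    rw [pathE_add, hfirst, pathE_tail hstat τ fun x => intTrans u τ x, ih]
    push_cast
    ring

end PathExpectation

/-- A sequence with constant second difference `2 c` from `N` on which stays within a bounded
distance of `n ^ 2 * c` has first difference `(2 N + 1) c` at `N`. -/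
theorem first_difference_eq_of_bounded {M : ℕ → ℝ} {c B : ℝ} {N : ℕ}
    (hrec : ∀ t, N ≤ t → M (t + 2) + M t = 2 * M (t + 1) + 2 * c)
    (hlow : ∀ t : ℕ, 0 ≤ M t - (t : ℝ) ^ 2 * c) (hup : ∀ t : ℕ, M t - (t : ℝ) ^ 2 * c ≤ B) :
    M (N + 1) - M N = (2 * N + 1) * c := by
  set d := M (N + 1) - M N - (2 * N + 1) * c with hd
  have hlin : ∀ s : ℕ, M (N + s) - ((N + s : ℕ) : ℝ) ^ 2 * c = M N - (N : ℝ) ^ 2 * c + s * d ∧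
      M (N + s + 1) - ((N + s + 1 : ℕ) : ℝ) ^ 2 * c = M N - (N : ℝ) ^ 2 * c + (s + 1) * d := by
    intro s
    induction s with
    | zero =>
      constructor
      · simp
      · rw [hd]
        push_cast
        simp only [add_zero]
        ring
    | succ s ih =>
      obtain ⟨h₁, h₂⟩ := ih
      have h := hrec (N + s) (Nat.le_add_right _ _)
      push_cast at h₁ h₂ ⊢
      simp only [← add_assoc]
      exact ⟨h₂, by linear_combination h + 2 * h₂ - h₁⟩
  have hbound : ∀ s : ℕ, |(s : ℝ) * d| ≤ B := by
    intro s
    have h := (hlin s).1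
    have h₁ := hlow (N + s)
    have h₂ := hup (N + s)
    have h₃ := hlow N
    have h₄ := hup N
    exact abs_le.2 ⟨by linarith, by linarith⟩
  suffices d = 0 by linarith
  by_contra hne
  obtain ⟨s, hs⟩ := exists_nat_gt (B / |d|)
  have h := hbound s
  rw [abs_mul, Nat.abs_cast] at h
  rw [div_lt_iff₀ (abs_pos.2 hne)] at hs
  linarith

/-- The solution formula of Lemma 5.4: under a finite full mixing time
(`C_t = μ²` for all `t ≥ τ*`, `τ* ≥ 2`) and bounded variance of the integrated
transport, setting `g(t) = t (τ* + 1/2) μ² - E[(S_t)²]/2`, the 2-point time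
correlator is the discrete time-Laplacian of `g`:
`C_0 = 2 g(1) - g(2)`, `C_t = 2 g(t+1) - g(t+2) - g(t)` for `1 ≤ t ≤ τ*-2`,
and `C_{τ*-1} = g(τ*) - g(τ*-1)`. -/
theorem correlator_is_discrete_laplacian_of_g
    {S : Type*} [Fintype S] [Nonempty S]
    (P : S → S → ℝ) (pi : S → ℝ) (u : S → S → ℝ)
    (hP : ∀ r r', 0 ≤ P r r') (hProw : ∀ r, ∑ r', P r r' = 1)
    (hpi : ∀ r, 0 ≤ pi r) (hpisum : ∑ r, pi r = 1)
    (hstat : ∀ r', ∑ r, pi r * P r r' = pi r')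
    (τstar : ℕ) (hτstar : 2 ≤ τstar)
    (hmix : ∀ t, τstar ≤ t → corr P pi u t = (mu P pi u) ^ 2)
    (B : ℝ) (hB : ∀ τ : ℕ, varS P pi u τ ≤ B)
    (g : ℕ → ℝ)
    (hg : ∀ t : ℕ, g t = (t : ℝ) * ((τstar : ℝ) + 1 / 2) * (mu P pi u) ^ 2
        - pathE P pi t (fun x => (intTrans u t x) ^ 2) / 2) :
    corr P pi u 0 = 2 * g 1 - g 2 ∧
    (∀ t : ℕ, 1 ≤ t → t ≤ τstar - 2 →
      corr P pi u t = 2 * g (t + 1) - g (t + 2) - g t) ∧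
    corr P pi u (τstar - 1) = g τstar - g (τstar - 1) := by
  set M : ℕ → ℝ := fun t => pathE P pi t (fun x => intTrans u t x ^ 2)
  have hg' : ∀ t : ℕ, g t = (t : ℝ) * ((τstar : ℝ) + 1 / 2) * (mu P pi u) ^ 2 - M t / 2 := hg
  have hrec : ∀ t, M (t + 2) + M t = 2 * M (t + 1) + 2 * corr P pi u t :=
    secondMoment_second_difference hProw hstat
  have hlap : ∀ t, corr P pi u t = 2 * g (t + 1) - g (t + 2) - g t := by
    intro t
    rw [hg', hg', hg']
    push_cast
    linear_combination -(hrec t) / 2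
  have hvar : ∀ t : ℕ, varS P pi u t = M t - (t : ℝ) ^ 2 * mu P pi u ^ 2 := by
    intro t
    rw [varS, pathE_intTrans hProw hstat, mul_pow]
  have hdiff : M (τstar + 1) - M τstar = (2 * τstar + 1) * mu P pi u ^ 2 :=
    first_difference_eq_of_bounded (B := B)
      (fun t ht => by rw [hrec, hmix t ht])
      (fun t => hvar t ▸ varS_nonneg hP hProw hpi hpisum t) (fun t => hvar t ▸ hB t)
  refine ⟨?_, fun t _ _ => hlap t, ?_⟩
  · have h0 : g 0 = 0 := by simp [hg, pathE, intTrans]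
    simpa [h0] using hlap 0
  · obtain ⟨n, rfl⟩ : ∃ n, τstar = n + 1 := ⟨τstar - 1, by omega⟩
    have h := hrec n
    rw [Nat.add_sub_cancel, hg', hg']
    push_cast at hdiff ⊢
    linear_combination -h / 2 + hdiff / 2
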